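/- Fix α ∈ [-1,1], T > 0 and admissible data (u_in, v_in, φ⁻, φ⁺). Then there exists a constant L > 0, depending only on α, T, φ⁻, φ⁺, u_in, v_in (and not on ε), such that for every ε > 0 and every classical solution (u_ε, v_ε) on [0,T] of the scaled generalized Carleman system with these data, setting ρ_ε = u_ε + v_ε and j_ε = (u_ε − v_ε)/ε, one has ∫₀ᵀ ∫₀¹ ρ_ε^{2α} j_ε² dx dt ≤ L. -/

import Mathlib

open MeasureTheory Set intervalIntegral

/-- Admissible data for the generalized Carleman system on `[0,T] × [0,1]`:
`C¹` positive boundary data `φ⁻, φ⁺` and continuous nonnegative initial data `u_in, v_in`. -/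
def AdmissibleData (T : ℝ) (φm φp uin vin : ℝ → ℝ) : Prop :=
  ContDiffOn ℝ 1 φm (Set.Icc 0 T) ∧ ContDiffOn ℝ 1 φp (Set.Icc 0 T) ∧
  (∀ t ∈ Set.Icc (0:ℝ) T, 0 < φm t ∧ 0 < φp t) ∧
  ContinuousOn uin (Set.Icc (0:ℝ) 1) ∧ ContinuousOn vin (Set.Icc (0:ℝ) 1) ∧
  (∀ x ∈ Set.Icc (0:ℝ) 1, 0 ≤ uin x ∧ 0 ≤ vin x)

/-- A classical solution of the scaled generalized Carleman system on `[0,T] × [0,1]`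
with parameter `α`, scaling `ε`, inflow boundary data `φ⁻, φ⁺` and initial data
`u_in, v_in`: a pair `(u,v)` of `C¹` functions, nonnegative with positive total density,
satisfying `ε² ∂ₜ u + ε ∂ₓ u = (u+v)^α (v-u)`, `ε² ∂ₜ v - ε ∂ₓ v = (u+v)^α (u-v)`
pointwise in the interior, together with the boundary and initial conditions. -/
def IsScaledCarlemanSol (α T ε : ℝ) (φm φp uin vin : ℝ → ℝ) (u v : ℝ → ℝ → ℝ) : Prop :=
  ContDiffOn ℝ 1 (fun p : ℝ × ℝ => u p.1 p.2) (Set.Icc 0 T ×ˢ Set.Icc (0:ℝ) 1) ∧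
  ContDiffOn ℝ 1 (fun p : ℝ × ℝ => v p.1 p.2) (Set.Icc 0 T ×ˢ Set.Icc (0:ℝ) 1) ∧
  (∀ t ∈ Set.Icc (0:ℝ) T, ∀ x ∈ Set.Icc (0:ℝ) 1,
      0 ≤ u t x ∧ 0 ≤ v t x ∧ 0 < u t x + v t x) ∧
  (∀ t ∈ Set.Ioo (0:ℝ) T, ∀ x ∈ Set.Ioo (0:ℝ) 1,
      ε ^ 2 * deriv (fun s => u s x) t + ε * deriv (fun y => u t y) x
        = (u t x + v t x) ^ α * (v t x - u t x) ∧
      ε ^ 2 * deriv (fun s => v s x) t - ε * deriv (fun y => v t y) x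
        = (u t x + v t x) ^ α * (u t x - v t x)) ∧
  (∀ t ∈ Set.Ioo (0:ℝ) T, u t 0 = φm t ∧ v t 1 = φp t) ∧
  (∀ x ∈ Set.Icc (0:ℝ) 1, u 0 x = uin x ∧ v 0 x = vin x)

/-- The iterated integral of a function continuous on a closed rectangle as a double integral. -/
lemma integral_integral_eq_setIntegral {τ : ℝ} (hτ : 0 ≤ τ) {H : ℝ × ℝ → ℝ}
    (hH : ContinuousOn H (Icc 0 τ ×ˢ Icc (0:ℝ) 1)) :
    IntegrableOn H (Ioo 0 τ ×ˢ Ioo (0:ℝ) 1) (volume.prod volume) ∧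
      (∫ t in (0:ℝ)..τ, ∫ x in (0:ℝ)..1, H (t, x)) =
        ∫ z in Ioo 0 τ ×ˢ Ioo (0:ℝ) 1, H z ∂(volume.prod volume) := by
  have hi : IntegrableOn H (Ioo 0 τ ×ˢ Ioo (0:ℝ) 1) (volume.prod volume) :=
    (hH.integrableOn_compact (isCompact_Icc.prod isCompact_Icc)).mono_set
      (prod_mono Ioo_subset_Icc_self Ioo_subset_Icc_self)
  refine ⟨hi, ?_⟩
  rw [setIntegral_prod _ hi]
  simp only [intervalIntegral.integral_of_le hτ, intervalIntegral.integral_of_le zero_le_one,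
    integral_Ioc_eq_integral_Ioo]

/-- Monotonicity of iterated integrals of functions continuous on a closed rectangle. -/
lemma integral_integral_mono_of_continuousOn {τ : ℝ} (hτ : 0 ≤ τ) {F G : ℝ × ℝ → ℝ}
    (hF : ContinuousOn F (Icc 0 τ ×ˢ Icc (0:ℝ) 1)) (hG : ContinuousOn G (Icc 0 τ ×ˢ Icc (0:ℝ) 1))
    (h : ∀ t ∈ Ioo 0 τ, ∀ x ∈ Ioo (0:ℝ) 1, F (t, x) ≤ G (t, x)) :
    (∫ t in (0:ℝ)..τ, ∫ x in (0:ℝ)..1, F (t, x)) ≤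
      ∫ t in (0:ℝ)..τ, ∫ x in (0:ℝ)..1, G (t, x) := by
  obtain ⟨hFi, hFe⟩ := integral_integral_eq_setIntegral hτ hF
  obtain ⟨hGi, hGe⟩ := integral_integral_eq_setIntegral hτ hG
  rw [hFe, hGe]
  refine setIntegral_mono_on hFi hGi (measurableSet_Ioo.prod measurableSet_Ioo) ?_
  rintro ⟨t, x⟩ ⟨ht, hx⟩
  exact h t ht x hx

/-- Integrated form of the differential inequality `∂ₜ f + ∂ₓ g ≤ d` on a rectangle. -/
lemma integral_balance_le {τ : ℝ} (hτ : 0 ≤ τ) {f g d : ℝ × ℝ → ℝ}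
    (hf : ContDiffOn ℝ 1 f (Icc 0 τ ×ˢ Icc (0:ℝ) 1))
    (hg : ContDiffOn ℝ 1 g (Icc 0 τ ×ˢ Icc (0:ℝ) 1))
    (hd : ContinuousOn d (Icc 0 τ ×ˢ Icc (0:ℝ) 1))
    (h : ∀ t ∈ Ioo 0 τ, ∀ x ∈ Ioo (0:ℝ) 1, ∃ a b, HasDerivAt (fun s => f (s, x)) a t ∧
      HasDerivAt (fun y => g (t, y)) b x ∧ a + b ≤ d (t, x)) :
    (∫ t in (0:ℝ)..τ, g (t, 1)) - (∫ t in (0:ℝ)..τ, g (t, 0)) + (∫ x in (0:ℝ)..1, f (τ, x))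
      - (∫ x in (0:ℝ)..1, f (0, x)) ≤ ∫ t in (0:ℝ)..τ, ∫ x in (0:ℝ)..1, d (t, x) := by
  rcases hτ.eq_or_lt with rfl | hτ'
  · simp
  set S := Icc 0 τ ×ˢ Icc (0:ℝ) 1 with hS
  have hSu : UniqueDiffOn ℝ S := (uniqueDiffOn_Icc hτ').prod (uniqueDiffOn_Icc zero_lt_one)
  have hK : IsCompact S := isCompact_Icc.prod isCompact_Icc
  have hnhds : ∀ z ∈ Ioo 0 τ ×ˢ Ioo (0:ℝ) 1, S ∈ nhds z := by
    rintro ⟨t, x⟩ ⟨ht, hx⟩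
    exact prod_mem_nhds (Icc_mem_nhds ht.1 ht.2) (Icc_mem_nhds hx.1 hx.2)
  have hfd : ∀ φ : ℝ × ℝ → ℝ, ContDiffOn ℝ 1 φ S → ∀ z ∈ Ioo 0 τ ×ˢ Ioo (0:ℝ) 1,
      HasFDerivAt φ (fderivWithin ℝ φ S z) z := fun φ hφ z hz =>
    ((hφ.differentiableOn one_ne_zero z (mem_of_mem_nhds (hnhds z hz))).hasFDerivWithinAt).hasFDerivAt
      (hnhds z hz)
  have hc : ContinuousOn
      (fun z => fderivWithin ℝ f S z (1, 0) + fderivWithin ℝ g S z (0, 1)) S :=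
    ((hf.continuousOn_fderivWithin hSu le_rfl).clm_apply continuousOn_const).add
      ((hg.continuousOn_fderivWithin hSu le_rfl).clm_apply continuousOn_const)
  have hdiv := integral2_divergence_prod_of_hasFDerivAt_off_countable f g
    (fderivWithin ℝ f S) (fderivWithin ℝ g S) 0 0 τ 1 ∅ countable_empty
    (by rw [uIcc_of_le hτ, uIcc_of_le zero_le_one]; exact hf.continuousOn)
    (by rw [uIcc_of_le hτ, uIcc_of_le zero_le_one]; exact hg.continuousOn)
    (by
      rw [min_eq_left hτ, max_eq_right hτ, min_eq_left zero_le_one, max_eq_right zero_le_one]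
      exact fun z hz => hfd f hf z hz.1)
    (by
      rw [min_eq_left hτ, max_eq_right hτ, min_eq_left zero_le_one, max_eq_right zero_le_one]
      exact fun z hz => hfd g hg z hz.1)
    (by
      rw [uIcc_of_le hτ, uIcc_of_le zero_le_one]
      exact hc.integrableOn_compact hK)
  rw [← hdiv]
  refine integral_integral_mono_of_continuousOn hτ hc hd fun t ht x hx => ?_
  obtain ⟨a, b, ha, hb, hab⟩ := h t ht x hx
  have h1 : HasDerivAt (fun s => f (s, x)) (fderivWithin ℝ f S (t, x) (1, 0)) t :=
    HasFDerivAt.comp_hasDerivAt t (hfd f hf (t, x) ⟨ht, hx⟩)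
      ((hasDerivAt_id t).prodMk (hasDerivAt_const t x))
  have h2 : HasDerivAt (fun y => g (t, y)) (fderivWithin ℝ g S (t, x) (0, 1)) x :=
    HasFDerivAt.comp_hasDerivAt x (hfd g hg (t, x) ⟨ht, hx⟩)
      ((hasDerivAt_const x t).prodMk (hasDerivAt_id x))
  rw [h1.unique ha, h2.unique hb]
  exact hab

/-- Interior partial derivatives of a classical solution, in transport form. -/
lemma IsScaledCarlemanSol.exists_hasDerivAt {α T ε : ℝ} (hε : 0 < ε) {φm φp uin vin : ℝ → ℝ}
    {u v : ℝ → ℝ → ℝ} (h : IsScaledCarlemanSol α T ε φm φp uin vin u v)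
    {t x : ℝ} (ht : t ∈ Ioo 0 T) (hx : x ∈ Ioo (0:ℝ) 1) :
    ∃ ut ux vt vx : ℝ, HasDerivAt (fun s => u s x) ut t ∧ HasDerivAt (fun y => u t y) ux x ∧
      HasDerivAt (fun s => v s x) vt t ∧ HasDerivAt (fun y => v t y) vx x ∧
      ut = -(u t x + v t x) ^ α * (u t x - v t x) / ε ^ 2 - ux / ε ∧
      vt = (u t x + v t x) ^ α * (u t x - v t x) / ε ^ 2 + vx / ε := by
  obtain ⟨hu, hv, -, hpde, -⟩ := h
  have hn : Icc 0 T ×ˢ Icc (0:ℝ) 1 ∈ nhds (t, x) :=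
    prod_mem_nhds (Icc_mem_nhds ht.1 ht.2) (Icc_mem_nhds hx.1 hx.2)
  have key : ∀ w : ℝ → ℝ → ℝ,
      ContDiffOn ℝ 1 (fun p : ℝ × ℝ => w p.1 p.2) (Icc 0 T ×ˢ Icc (0:ℝ) 1) →
      DifferentiableAt ℝ (fun s => w s x) t ∧ DifferentiableAt ℝ (fun y => w t y) x := by
    intro w hw
    have hd : DifferentiableAt ℝ (fun p : ℝ × ℝ => w p.1 p.2) (t, x) :=
      (hw.differentiableOn one_ne_zero).differentiableAt hn
    exact ⟨DifferentiableAt.comp (f := fun s => (s, x)) t hd (by fun_prop),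
      DifferentiableAt.comp (f := fun y => (t, y)) x hd (by fun_prop)⟩
  obtain ⟨e1, e2⟩ := hpde t ht x hx
  refine ⟨_, _, _, _, (key u hu).1.hasDerivAt, (key u hu).2.hasDerivAt,
    (key v hv).1.hasDerivAt, (key v hv).2.hasDerivAt, ?_, ?_⟩
  · field_simp
    linarith
  · field_simp
    linarith

/-- An interval integral is nonnegative if the integrand is so on the open interval. -/
lemma intervalIntegral_nonneg_of_Ioo {a b : ℝ} (hab : a ≤ b) {f : ℝ → ℝ}
    (h : ∀ t ∈ Ioo a b, 0 ≤ f t) : 0 ≤ ∫ t in a..b, f t := by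
  rw [intervalIntegral.integral_of_le hab, integral_Ioc_eq_integral_Ioo]
  exact setIntegral_nonneg measurableSet_Ioo h

/-- A `C¹` function vanishing on `(-∞, 0]`, positive on `(0, ∞)`, with monotone derivative. -/
lemma exists_convex_cutoff : ∃ ψ ψ' : ℝ → ℝ, ContDiff ℝ 1 ψ ∧ (∀ s, HasDerivAt ψ (ψ' s) s) ∧
    Monotone ψ' ∧ (∀ s, 0 ≤ ψ s) ∧ (∀ s ≤ 0, ψ s = 0) ∧ ∀ s, 0 < s → 0 < ψ s := by
  have hcd : ContDiff ℝ 1 (fun s : ℝ => ‖s‖ ^ (3:ℝ) + s ^ 3) :=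
    (contDiff_norm_rpow (by norm_num)).add (contDiff_id.pow 3)
  refine ⟨fun s => ‖s‖ ^ (3:ℝ) + s ^ 3, fun s => 3 * |s| * s + 3 * s ^ 2, hcd, fun s => ?_,
    fun a b hab => ?_, fun s => ?_, fun s hs => ?_, fun s hs => ?_⟩
  · have h1 := hasDerivAt_abs_rpow s (p := 3) (by norm_num)
    refine (h1.add (hasDerivAt_pow 3 s)).congr_deriv ?_
    norm_num
  · rcases le_total 0 a with ha | ha
    · have hb := ha.trans hab
      simp only [abs_of_nonneg ha, abs_of_nonneg hb]
      nlinarith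
    · simp only [abs_of_nonpos ha]
      rcases le_total 0 b with hb | hb
      · rw [abs_of_nonneg hb]
        nlinarith
      · rw [abs_of_nonpos hb]
        nlinarith
  all_goals
    have h3 : ‖s‖ ^ (3:ℝ) = |s| ^ 3 := by
      rw [Real.norm_eq_abs]; exact_mod_cast Real.rpow_natCast |s| 3
    simp only [h3]
  · have : |s ^ 3| = |s| ^ 3 := abs_pow s 3
    linarith [neg_abs_le (s ^ 3)]
  · rw [abs_of_nonpos hs]
    ring
  · positivity

/-- Maximum principle: an upper bound of the data bounds the solution. -/
lemma IsScaledCarlemanSol.le_of_data_le {α T ε : ℝ} (hε : 0 < ε)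
    {φm φp uin vin : ℝ → ℝ} {u v : ℝ → ℝ → ℝ}
    (h : IsScaledCarlemanSol α T ε φm φp uin vin u v) {M : ℝ}
    (hm : ∀ t ∈ Icc 0 T, φm t ≤ M) (hp : ∀ t ∈ Icc 0 T, φp t ≤ M)
    (hui : ∀ x ∈ Icc (0:ℝ) 1, uin x ≤ M) (hvi : ∀ x ∈ Icc (0:ℝ) 1, vin x ≤ M) :
    ∀ t ∈ Icc 0 T, ∀ x ∈ Icc (0:ℝ) 1, u t x ≤ M ∧ v t x ≤ M := by
  intro τ hτ x₀ hx₀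
  obtain ⟨hu, hv, hpos, -, hbd, hin⟩ := id h
  obtain ⟨ψ, ψ', hψ, hψd, hψm, hψ0, hψz, hψp⟩ := exists_convex_cutoff
  rcases hτ.1.eq_or_lt with rfl | hτ0
  · rw [(hin x₀ hx₀).1, (hin x₀ hx₀).2]
    exact ⟨hui x₀ hx₀, hvi x₀ hx₀⟩
  have hsub : Icc 0 τ ×ˢ Icc (0:ℝ) 1 ⊆ Icc 0 T ×ˢ Icc (0:ℝ) 1 :=
    prod_mono (Icc_subset_Icc_right hτ.2) subset_rfl
  have hfu : ContDiffOn ℝ 1 (fun p : ℝ × ℝ => ψ (u p.1 p.2 - M)) (Icc 0 τ ×ˢ Icc (0:ℝ) 1) :=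
    hψ.comp_contDiffOn ((hu.mono hsub).sub contDiffOn_const)
  have hfv : ContDiffOn ℝ 1 (fun p : ℝ × ℝ => ψ (v p.1 p.2 - M)) (Icc 0 τ ×ˢ Icc (0:ℝ) 1) :=
    hψ.comp_contDiffOn ((hv.mono hsub).sub contDiffOn_const)
  have hbal := integral_balance_le hτ0.le (hfu.add hfv) ((hfu.sub hfv).div_const ε)
    (d := fun _ => 0) continuousOn_const (by
      intro t ht x hx
      have ht' : t ∈ Ioo 0 T := ⟨ht.1, ht.2.trans_le hτ.2⟩
      obtain ⟨ut, ux, vt, vx, d1, d2, d3, d4, e1, e2⟩ := h.exists_hasDerivAt hε ht' hx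
      refine ⟨_, _, ((hψd _).comp t (d1.sub_const M)).add ((hψd _).comp t (d3.sub_const M)),
        (((hψd _).comp x (d2.sub_const M)).sub ((hψd _).comp x (d4.sub_const M))).div_const ε, ?_⟩
      have hk : 0 ≤ (u t x + v t x) ^ α :=
        Real.rpow_nonneg (hpos t (Ioo_subset_Icc_self ht') x (Ioo_subset_Icc_self hx)).2.2.le α
      have hmul : 0 ≤ (u t x - v t x) * (ψ' (u t x - M) - ψ' (v t x - M)) := by
        rcases le_total (u t x) (v t x) with hle | hle
        · exact mul_nonneg_of_nonpos_of_nonpos (by linarith)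
            (by linarith [hψm (sub_le_sub_right hle M)])
        · exact mul_nonneg (by linarith) (by linarith [hψm (sub_le_sub_right hle M)])
      have : 0 ≤ (u t x + v t x) ^ α * ((u t x - v t x) * (ψ' (u t x - M) - ψ' (v t x - M)))
          / ε ^ 2 := by positivity
      rw [e1, e2]
      refine le_of_eq_of_le ?_ (neg_nonpos.mpr this)
      field_simp
      ring)
  have hg1 : 0 ≤ ∫ t in (0:ℝ)..τ, (ψ (u t 1 - M) - ψ (v t 1 - M)) / ε := by
    refine intervalIntegral_nonneg_of_Ioo hτ0.le fun t ht => ?_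
    have ht' : t ∈ Ioo 0 T := ⟨ht.1, ht.2.trans_le hτ.2⟩
    rw [(hbd t ht').2, hψz (φp t - M) (by linarith [hp t (Ioo_subset_Icc_self ht')]), sub_zero]
    exact div_nonneg (hψ0 _) hε.le
  have hg0 : 0 ≤ ∫ t in (0:ℝ)..τ, -((ψ (u t 0 - M) - ψ (v t 0 - M)) / ε) := by
    refine intervalIntegral_nonneg_of_Ioo hτ0.le fun t ht => ?_
    have ht' : t ∈ Ioo 0 T := ⟨ht.1, ht.2.trans_le hτ.2⟩
    rw [(hbd t ht').1, hψz (φm t - M) (by linarith [hm t (Ioo_subset_Icc_self ht')]), zero_sub,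
      neg_div, neg_neg]
    exact div_nonneg (hψ0 _) hε.le
  have hf0 : ∫ x in (0:ℝ)..1, (ψ (u 0 x - M) + ψ (v 0 x - M)) = 0 := by
    refine (intervalIntegral.integral_congr fun x hx => ?_).trans intervalIntegral.integral_zero
    rw [uIcc_of_le zero_le_one] at hx
    simp only [(hin x hx).1, (hin x hx).2]
    rw [hψz _ (by linarith [hui x hx]), hψz _ (by linarith [hvi x hx]), add_zero]
  rw [intervalIntegral.integral_neg] at hg0
  simp only [intervalIntegral.integral_zero, hf0] at hbal
  by_contra hcon
  have hc : 0 < ψ (u τ x₀ - M) + ψ (v τ x₀ - M) := by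
    rw [not_and_or, not_le, not_le] at hcon
    rcases hcon with hcon | hcon
    · exact add_pos_of_pos_of_nonneg (hψp _ (by linarith)) (hψ0 _)
    · exact add_pos_of_nonneg_of_pos (hψ0 _) (hψp _ (by linarith))
  have hcont : ContinuousOn (fun x => ψ (u τ x - M) + ψ (v τ x - M)) (Icc (0:ℝ) 1) :=
    (hfu.add hfv).continuousOn.comp (continuousOn_const.prodMk continuousOn_id)
      fun x hx => ⟨⟨hτ0.le, le_rfl⟩, hx⟩
  have := intervalIntegral.integral_pos zero_lt_one hcont
    (fun x _ => add_nonneg (hψ0 _) (hψ0 _)) ⟨x₀, hx₀, hc⟩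
  linarith

lemma sq_div_add_le_sub_mul_log_sub {a b : ℝ} (ha : 0 < a) (hb : 0 < b) :
    (a - b) ^ 2 / (a + b) ≤ (a - b) * (Real.log a - Real.log b) := by
  wlog hab : b ≤ a generalizing a b
  · have := this hb ha (le_of_not_ge hab)
    rw [add_comm b a, ← neg_sub a b, neg_sq] at this
    linarith
  have h1 : (a - b) / (a + b) ≤ Real.log a - Real.log b := by
    have h2 := Real.one_sub_inv_le_log_of_pos (div_pos ha hb)
    rw [Real.log_div ha.ne' hb.ne', inv_div] at h2
    refine le_trans ?_ h2
    rw [one_sub_div ha.ne']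
    exact div_le_div_of_nonneg_left (by linarith) ha (by linarith)
  calc (a - b) ^ 2 / (a + b) = (a - b) * ((a - b) / (a + b)) := by ring
    _ ≤ _ := mul_le_mul_of_nonneg_left h1 (by linarith)

/-- Lower bound for the production of the logarithmic entropy shifted by `κ`. -/
lemma entropy_dissipation_lower_bound {α : ℝ} (hα : α ∈ Icc (-1:ℝ) 1) {a b κ N j : ℝ} {ε : ℝ}
    (ha : 0 ≤ a) (hb : 0 ≤ b) (hκ : 0 < κ) (hκρ : κ ≤ a + b) (hN : 1 ≤ N) (hρN : a + b ≤ N)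
    (hj : j = (a - b) / ε) :
    ((a + b) ^ (2 * α) * j ^ 2 + j ^ 2) / (6 * N ^ 2) ≤
      (a + b) ^ α * (a - b) * (Real.log (a + κ) - Real.log (b + κ)) / ε ^ 2 := by
  have hρ : 0 < a + b := hκ.trans_le hκρ
  have hlog := sq_div_add_le_sub_mul_log_sub (a := a + κ) (b := b + κ) (by linarith) (by linarith)
  rw [add_sub_add_right_eq_sub] at hlog
  have h3 : (a - b) ^ 2 / (3 * (a + b)) ≤ (a - b) ^ 2 / (a + κ + (b + κ)) :=
    div_le_div_of_nonneg_left (sq_nonneg _) (by linarith) (by linarith)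
  have hpow : ∀ s ∈ Icc (0:ℝ) 2, (a + b) ^ s ≤ N ^ 2 := fun s hs =>
    calc (a + b) ^ s ≤ N ^ s := Real.rpow_le_rpow hρ.le hρN hs.1
      _ ≤ N ^ (2:ℝ) := Real.rpow_le_rpow_of_exponent_le hN hs.2
      _ = N ^ 2 := Real.rpow_two N
  have hq : 0 < (a + b) ^ (α - 1) := Real.rpow_pos_of_pos hρ _
  have h4 : (a + b) ^ (2 * α) ≤ (a + b) ^ (α - 1) * N ^ 2 := by
    rw [show 2 * α = (α - 1) + (α + 1) by ring, Real.rpow_add hρ]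
    exact mul_le_mul_of_nonneg_left (hpow _ ⟨by linarith [hα.1], by linarith [hα.2]⟩) hq.le
  have h5 : 1 ≤ (a + b) ^ (α - 1) * N ^ 2 := by
    calc (1:ℝ) = (a + b) ^ (α - 1) * (a + b) ^ (1 - α) := by
          rw [← Real.rpow_add hρ]; simp
      _ ≤ _ := mul_le_mul_of_nonneg_left (hpow _ ⟨by linarith [hα.2], by linarith [hα.1]⟩) hq.le
  have h6 : (a + b) ^ α = (a + b) ^ (α - 1) * (a + b) := by
    rw [← Real.rpow_add_one hρ.ne', sub_add_cancel]
  have hN2 : 0 < N ^ 2 := by positivity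
  calc ((a + b) ^ (2 * α) * j ^ 2 + j ^ 2) / (6 * N ^ 2)
      ≤ (2 * ((a + b) ^ (α - 1) * N ^ 2) * j ^ 2) / (6 * N ^ 2) := by
        gcongr
        nlinarith [sq_nonneg j]
    _ = (a + b) ^ (α - 1) * (a + b) * ((a - b) ^ 2 / (3 * (a + b))) / ε ^ 2 := by
        rw [hj, div_pow]
        field_simp
        ring
    _ ≤ (a + b) ^ (α - 1) * (a + b) * ((a - b) * (Real.log (a + κ) - Real.log (b + κ)))
          / ε ^ 2 := by
        gcongr
        exact h3.trans hlog
    _ = _ := by rw [h6]; ring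

/-- Bounds on `log (φ + κ)` and its derivative, uniform in the shift `κ ∈ (0,1]`. -/
lemma exists_bound_log_add {T : ℝ} (hT : 0 < T) {φ : ℝ → ℝ} (hφ : ContDiffOn ℝ 1 φ (Icc 0 T))
    (hpos : ∀ t ∈ Icc 0 T, 0 < φ t) :
    ∃ K : ℝ, 1 ≤ K ∧ (∀ t ∈ Icc 0 T, φ t ≤ K) ∧ ∀ κ ∈ Ioc (0:ℝ) 1,
      (∀ t ∈ Icc 0 T, |Real.log (φ t + κ)| ≤ K) ∧
      ∀ t ∈ Ioo 0 T, ∃ a, HasDerivAt (fun s => Real.log (φ s + κ)) a t ∧ |a| ≤ K := by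
  obtain ⟨t₀, ht₀, hmin⟩ := isCompact_Icc.exists_isMinOn (nonempty_Icc.mpr hT.le) hφ.continuousOn
  obtain ⟨B, hB⟩ := isCompact_Icc.exists_bound_of_continuousOn hφ.continuousOn
  obtain ⟨D, hD⟩ := isCompact_Icc.exists_bound_of_continuousOn
    (hφ.continuousOn_derivWithin (uniqueDiffOn_Icc hT) le_rfl)
  have hm := hpos t₀ ht₀
  have hB' : ∀ t ∈ Icc 0 T, φ t ≤ |B| := fun t ht =>
    (le_abs_self _).trans ((hB t ht).trans (le_abs_self B))
  have hquot : 0 ≤ |D| / φ t₀ := by positivity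
  refine ⟨1 + |B| + |Real.log (φ t₀)| + |D| / φ t₀, ?_, fun t ht => ?_, fun κ hκ =>
    ⟨fun t ht => ?_, fun t ht => ?_⟩⟩
  · linarith [abs_nonneg B, abs_nonneg (Real.log (φ t₀))]
  · linarith [hB' t ht, abs_nonneg (Real.log (φ t₀))]
  · have hle : φ t₀ ≤ φ t + κ := by linarith [isMinOn_iff.mp hmin t ht, hκ.1]
    have h1 := Real.log_le_log hm hle
    have h2 := Real.log_le_sub_one_of_pos (hm.trans_le hle)
    rw [abs_le]
    constructor
    · linarith [neg_abs_le (Real.log (φ t₀)), abs_nonneg B]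
    · linarith [hB' t ht, hκ.2, abs_nonneg (Real.log (φ t₀))]
  · have ht' := Ioo_subset_Icc_self ht
    have hle : φ t₀ ≤ φ t + κ := by linarith [isMinOn_iff.mp hmin t ht', hκ.1]
    have hd : HasDerivAt φ (derivWithin φ (Icc 0 T) t) t :=
      ((hφ.differentiableOn one_ne_zero t ht').hasDerivWithinAt).hasDerivAt
        (Icc_mem_nhds ht.1 ht.2)
    refine ⟨_, (hd.add_const κ).log (hm.trans_le hle).ne', ?_⟩
    rw [abs_div, abs_of_pos (hm.trans_le hle)]
    have h1 : |derivWithin φ (Icc 0 T) t| / (φ t + κ) ≤ |D| / φ t₀ :=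
      div_le_div₀ (abs_nonneg D) ((hD t ht').trans (le_abs_self D)) hm hle
    linarith [abs_nonneg B, abs_nonneg (Real.log (φ t₀))]

/-- Young's inequality for the logarithmic entropy. -/
lemma mul_log_sub_nonneg {a l : ℝ} (ha : 0 < a) :
    0 ≤ a * Real.log a - a - l * a + Real.exp l := by
  have h := Real.add_one_le_exp (l - Real.log a)
  have h2 : Real.exp l = a * Real.exp (l - Real.log a) := by
    rw [Real.exp_sub, Real.exp_log ha]; field_simp
  rw [h2]
  nlinarith

/-- Entropy estimate relative to the affine interpolation of `A = log (φ⁻ + κ)` and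
`B = log (φ⁺ + κ)`, with constants depending only on the bound `K` for the data. -/
lemma IsScaledCarlemanSol.integral_le_of_bounds {α T ε κ K : ℝ} (hα : α ∈ Icc (-1:ℝ) 1)
    (hT : 0 < T) (hε : 0 < ε) {φm φp uin vin : ℝ → ℝ} {u v : ℝ → ℝ → ℝ}
    (h : IsScaledCarlemanSol α T ε φm φp uin vin u v) (hκ : κ ∈ Ioc (0:ℝ) 1)
    (hκρ : ∀ t ∈ Icc 0 T, ∀ x ∈ Icc (0:ℝ) 1, κ ≤ u t x + v t x) (hK : 1 ≤ K)
    (huv : ∀ t ∈ Icc 0 T, ∀ x ∈ Icc (0:ℝ) 1, u t x ≤ K ∧ v t x ≤ K)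
    {A B : ℝ → ℝ} (hA : ContDiffOn ℝ 1 A (Icc 0 T)) (hB : ContDiffOn ℝ 1 B (Icc 0 T))
    (hAφ : ∀ t ∈ Ioo 0 T, A t = Real.log (φm t + κ) ∧ B t = Real.log (φp t + κ))
    (hAK : ∀ t ∈ Icc 0 T, |A t| ≤ K) (hBK : ∀ t ∈ Icc 0 T, |B t| ≤ K)
    (hA' : ∀ t ∈ Ioo 0 T, ∃ a, HasDerivAt A a t ∧ |a| ≤ K)
    (hB' : ∀ t ∈ Ioo 0 T, ∃ b, HasDerivAt B b t ∧ |b| ≤ K) :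
    (∫ t in (0:ℝ)..T, ∫ x in (0:ℝ)..1,
        (u t x + v t x) ^ (2 * α) * ((u t x - v t x) / ε) ^ 2) ≤
      24 * K ^ 2 * ((2 * K * Real.exp K + 2 * K ^ 2 + 2 * K + 24 * K ^ 4) * T
        + 2 * ((K + 1) ^ 2 + K * (K + 1) + Real.exp K)) := by
  obtain ⟨hu, hv, hpos, -, hbd, hin⟩ := id h
  set S := Icc 0 T ×ˢ Icc (0:ℝ) 1 with hS
  set C := 2 * K * Real.exp K + 2 * K ^ 2 + 2 * K + 24 * K ^ 4 with hC
  set F := (K + 1) ^ 2 + K * (K + 1) + Real.exp K with hF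
  set l : ℝ → ℝ → ℝ := fun t x => (1 - x) * A t + x * B t with hl
  have hlK : ∀ a b x : ℝ, x ∈ Icc (0:ℝ) 1 → |a| ≤ K → |b| ≤ K →
      |(1 - x) * a + x * b| ≤ K := by
    intro a b x hx ha hb
    rw [abs_le] at ha hb ⊢
    constructor <;> nlinarith [hx.1, hx.2]
  have hlc : ContDiffOn ℝ 1 (fun p : ℝ × ℝ => l p.1 p.2) S := by
    have hA2 : ContDiffOn ℝ 1 (fun p : ℝ × ℝ => A p.1) S :=
      hA.comp contDiff_fst.contDiffOn fun p hp => hp.1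
    have hB2 : ContDiffOn ℝ 1 (fun p : ℝ × ℝ => B p.1) S :=
      hB.comp contDiff_fst.contDiffOn fun p hp => hp.1
    exact ((contDiffOn_const.sub contDiff_snd.contDiffOn).mul hA2).add
      (contDiff_snd.contDiffOn.mul hB2)
  set e : (ℝ → ℝ → ℝ) → ℝ × ℝ → ℝ := fun w p =>
    (w p.1 p.2 + κ) * Real.log (w p.1 p.2 + κ) - (w p.1 p.2 + κ)
      - l p.1 p.2 * (w p.1 p.2 + κ) + Real.exp (l p.1 p.2) with he
  have hec : ∀ w : ℝ → ℝ → ℝ, ContDiffOn ℝ 1 (fun p : ℝ × ℝ => w p.1 p.2) S →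
      (∀ t ∈ Icc 0 T, ∀ x ∈ Icc (0:ℝ) 1, 0 ≤ w t x) → ContDiffOn ℝ 1 (e w) S := by
    intro w hw hw0
    have hw1 : ContDiffOn ℝ 1 (fun p : ℝ × ℝ => w p.1 p.2 + κ) S := hw.add contDiffOn_const
    exact (((hw1.mul (hw1.log fun p hp => (add_pos_of_nonneg_of_pos
      (hw0 p.1 hp.1 p.2 hp.2) hκ.1).ne')).sub hw1).sub (hlc.mul hw1)).add hlc.exp
  have hed : ∀ (q m : ℝ → ℝ) (q' m' s : ℝ), HasDerivAt q q' s → HasDerivAt m m' s →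
      0 < q s + κ →
      HasDerivAt (fun r => (q r + κ) * Real.log (q r + κ) - (q r + κ) - m r * (q r + κ)
        + Real.exp (m r))
        ((Real.log (q s + κ) - m s) * q' - m' * (q s + κ) + Real.exp (m s) * m') s := by
    intro q m q' m' s hq hm hqs
    have h1 := hq.add_const κ
    refine ((((h1.mul (h1.log hqs.ne')).sub h1).sub (hm.mul h1)).add hm.exp).congr_deriv ?_
    field_simp
    ring
  have hu0 : ∀ t ∈ Icc 0 T, ∀ x ∈ Icc (0:ℝ) 1, 0 ≤ u t x := fun t ht x hx => (hpos t ht x hx).1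
  have hv0 : ∀ t ∈ Icc 0 T, ∀ x ∈ Icc (0:ℝ) 1, 0 ≤ v t x := fun t ht x hx => (hpos t ht x hx).2.1
  have he0 : ∀ w : ℝ → ℝ → ℝ, (∀ t ∈ Icc 0 T, ∀ x ∈ Icc (0:ℝ) 1, 0 ≤ w t x) →
      ∀ t ∈ Icc 0 T, ∀ x ∈ Icc (0:ℝ) 1, 0 ≤ e w (t, x) := fun w hw t ht x hx =>
    mul_log_sub_nonneg (add_pos_of_nonneg_of_pos (hw t ht x hx) hκ.1)
  have heF : ∀ w : ℝ → ℝ → ℝ, (∀ t ∈ Icc 0 T, ∀ x ∈ Icc (0:ℝ) 1, 0 ≤ w t x) →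
      (∀ t ∈ Icc 0 T, ∀ x ∈ Icc (0:ℝ) 1, w t x ≤ K) →
      ∀ t ∈ Icc 0 T, ∀ x ∈ Icc (0:ℝ) 1, e w (t, x) ≤ F := by
    intro w hw hwK t ht x hx
    have h1 : 0 < w t x + κ := add_pos_of_nonneg_of_pos (hw t ht x hx) hκ.1
    have h2 : w t x + κ ≤ K + 1 := add_le_add (hwK t ht x hx) hκ.2
    have h3 := Real.log_le_sub_one_of_pos h1
    have h4 := abs_le.mp (hlK _ _ x hx (hAK t ht) (hBK t ht))
    have h5 : Real.exp (l t x) ≤ Real.exp K := Real.exp_le_exp.mpr h4.2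
    have h6 : -l t x * (w t x + κ) ≤ K * (K + 1) :=
      mul_le_mul (by linarith [h4.1]) h2 h1.le (by linarith)
    have h7 : (w t x + κ) * Real.log (w t x + κ) ≤ (K + 1) ^ 2 := by
      rw [sq]
      exact (mul_le_mul_of_nonneg_left (by linarith : _ ≤ K + 1) h1.le).trans
        (mul_le_mul_of_nonneg_right h2 (by linarith))
    simp only [he, hF]
    linarith
  have hez : ∀ (w : ℝ → ℝ → ℝ) (t x : ℝ), 0 < w t x + κ → l t x = Real.log (w t x + κ) →
      e w (t, x) = 0 := by
    intro w t x hw hlw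
    simp only [he, hlw, Real.exp_log hw]
    ring
  set d : ℝ × ℝ → ℝ := fun p => C - (u p.1 p.2 + v p.1 p.2) ^ (2 * α) *
    ((u p.1 p.2 - v p.1 p.2) / ε) ^ 2 / (24 * K ^ 2) with hd
  have hIc : ContinuousOn (fun p : ℝ × ℝ => (u p.1 p.2 + v p.1 p.2) ^ (2 * α) *
      ((u p.1 p.2 - v p.1 p.2) / ε) ^ 2) S :=
    ((hu.continuousOn.add hv.continuousOn).rpow_const fun p hp =>
      Or.inl (hpos p.1 hp.1 p.2 hp.2).2.2.ne').mul
      (((hu.continuousOn.sub hv.continuousOn).div_const ε).pow 2)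
  have hdc : ContinuousOn d S := continuousOn_const.sub (hIc.div_const _)
  have hbal := integral_balance_le hT.le ((hec u hu hu0).add (hec v hv hv0))
    (((hec u hu hu0).sub (hec v hv hv0)).div_const ε) hdc (by
      intro t ht x hx
      have ht' := Ioo_subset_Icc_self ht
      have hx' := Ioo_subset_Icc_self hx
      obtain ⟨ut, ux, vt, vx, d1, d2, d3, d4, e1, e2⟩ := h.exists_hasDerivAt hε ht hx
      obtain ⟨a, hda, haK⟩ := hA' t ht
      obtain ⟨b, hdb, hbK⟩ := hB' t ht
      have hU : 0 < u t x + κ := add_pos_of_nonneg_of_pos (hu0 t ht' x hx') hκ.1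
      have hV : 0 < v t x + κ := add_pos_of_nonneg_of_pos (hv0 t ht' x hx') hκ.1
      have hlt : HasDerivAt (fun s => l s x) ((1 - x) * a + x * b) t :=
        (hda.const_mul (1 - x)).add (hdb.const_mul x)
      have hlx : HasDerivAt (fun y => l t y) (B t - A t) x :=
        ((((hasDerivAt_id x).const_sub 1).mul_const (A t)).add
          ((hasDerivAt_id x).mul_const (B t))).congr_deriv (by ring)
      refine ⟨_, _, (hed _ _ _ _ t d1 hlt hU).add (hed _ _ _ _ t d3 hlt hV),
        ((hed _ _ _ _ x d2 hlx hU).sub (hed _ _ _ _ x d4 hlx hV)).div_const ε, ?_⟩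
      obtain ⟨huK, hvK⟩ := huv t ht' x hx'
      have hdis := entropy_dissipation_lower_bound (ε := ε) (N := 2 * K) hα (hu0 t ht' x hx')
        (hv0 t ht' x hx') hκ.1 (hκρ t ht' x hx') (by linarith) (by linarith) rfl
      have hltK := abs_le.mp (hlK a b x hx' haK hbK)
      have hlK' := abs_le.mp (hlK _ _ x hx' (hAK t ht') (hBK t ht'))
      have hAt := abs_le.mp (hAK t ht')
      have hBt := abs_le.mp (hBK t ht')
      have hexp : Real.exp (l t x) ≤ Real.exp K := Real.exp_le_exp.mpr hlK'.2
      have hexp0 := Real.exp_pos (l t x)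
      set j := (u t x - v t x) / ε with hj
      set R := (u t x + v t x) ^ α * (u t x - v t x) *
        (Real.log (u t x + κ) - Real.log (v t x + κ)) / ε ^ 2 with hR
      set m := (1 - x) * a + x * b with hm
      have h1 : m * (2 * Real.exp (l t x)) ≤ K * (2 * Real.exp K) :=
        mul_le_mul hltK.2 (by linarith) (by positivity) (by linarith)
      have h2 : -m * (u t x + κ + (v t x + κ)) ≤ K * (2 * (K + 1)) :=
        mul_le_mul (by linarith [hltK.1]) (by linarith [hκ.2]) (by linarith) (by linarith)
      have hlx2 : (B t - A t) ^ 2 ≤ (2 * K) ^ 2 := sq_le_sq' (by linarith) (by linarith)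
      have h3 : -(B t - A t) * j ≤ j ^ 2 / (24 * K ^ 2) + 24 * K ^ 4 := by
        have hK2 : 0 < 24 * K ^ 2 := by positivity
        have h4 : -(B t - A t) * j ≤ j ^ 2 / (24 * K ^ 2) + (24 * K ^ 2) * (B t - A t) ^ 2 / 4 := by
          have : j ^ 2 / (24 * K ^ 2) + (24 * K ^ 2) * (B t - A t) ^ 2 / 4 + (B t - A t) * j
              = (j + 12 * K ^ 2 * (B t - A t)) ^ 2 / (24 * K ^ 2) := by
            field_simp
            ring
          have h5 : 0 ≤ (j + 12 * K ^ 2 * (B t - A t)) ^ 2 / (24 * K ^ 2) := by positivity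
          linarith
        have h6 : 24 * K ^ 2 * (B t - A t) ^ 2 ≤ 24 * K ^ 2 * (2 * K) ^ 2 :=
          mul_le_mul_of_nonneg_left hlx2 hK2.le
        linarith
      rw [show 6 * (2 * K) ^ 2 = 24 * K ^ 2 by ring, add_div] at hdis
      have hid : (Real.log (u t x + κ) - l t x) * ut - m * (u t x + κ) + Real.exp (l t x) * m
          + ((Real.log (v t x + κ) - l t x) * vt - m * (v t x + κ) + Real.exp (l t x) * m)
          + ((Real.log (u t x + κ) - l t x) * ux - (B t - A t) * (u t x + κ)
              + Real.exp (l t x) * (B t - A t)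
            - ((Real.log (v t x + κ) - l t x) * vx - (B t - A t) * (v t x + κ)
              + Real.exp (l t x) * (B t - A t))) / ε
          = -R + m * (2 * Real.exp (l t x)) + -m * (u t x + κ + (v t x + κ))
            + -(B t - A t) * j := by
        rw [e1, e2, hR, hj]
        field_simp
        ring
      refine hid.trans_le ?_
      simp only [hd, hC]
      linarith)
  have hg1 : 0 ≤ ∫ t in (0:ℝ)..T, (e u (t, 1) - e v (t, 1)) / ε := by
    refine intervalIntegral_nonneg_of_Ioo hT.le fun t ht => ?_
    have ht' := Ioo_subset_Icc_self ht
    have h1 : (1:ℝ) ∈ Icc (0:ℝ) 1 := ⟨zero_le_one, le_rfl⟩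
    rw [hez v t 1 (add_pos_of_nonneg_of_pos (hv0 t ht' 1 h1) hκ.1)
      (by rw [(hbd t ht).2, ← (hAφ t ht).2]; simp [hl]), sub_zero]
    exact div_nonneg (he0 u hu0 t ht' 1 h1) hε.le
  have hg0 : 0 ≤ ∫ t in (0:ℝ)..T, -((e u (t, 0) - e v (t, 0)) / ε) := by
    refine intervalIntegral_nonneg_of_Ioo hT.le fun t ht => ?_
    have ht' := Ioo_subset_Icc_self ht
    have h0 : (0:ℝ) ∈ Icc (0:ℝ) 1 := ⟨le_rfl, zero_le_one⟩
    rw [hez u t 0 (add_pos_of_nonneg_of_pos (hu0 t ht' 0 h0) hκ.1)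
      (by rw [(hbd t ht).1, ← (hAφ t ht).1]; simp [hl]), zero_sub, neg_div, neg_neg]
    exact div_nonneg (he0 v hv0 t ht' 0 h0) hε.le
  have hfT : 0 ≤ ∫ x in (0:ℝ)..1, (e u (T, x) + e v (T, x)) :=
    intervalIntegral.integral_nonneg zero_le_one fun x hx =>
      add_nonneg (he0 u hu0 T ⟨hT.le, le_rfl⟩ x hx) (he0 v hv0 T ⟨hT.le, le_rfl⟩ x hx)
  have h0T : (0:ℝ) ∈ Icc 0 T := ⟨le_rfl, hT.le⟩
  have hf0 : ∫ x in (0:ℝ)..1, (e u (0, x) + e v (0, x)) ≤ 2 * F := by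
    have hc : ContinuousOn (fun x => e u (0, x) + e v (0, x)) (Icc (0:ℝ) 1) :=
      ((hec u hu hu0).add (hec v hv hv0)).continuousOn.comp
        (continuousOn_const.prodMk continuousOn_id) fun x hx => ⟨h0T, hx⟩
    have := intervalIntegral.integral_mono_on (μ := volume) (g := fun _ => 2 * F) zero_le_one
      (hc.intervalIntegrable_of_Icc zero_le_one) (continuousOn_const.intervalIntegrable_of_Icc zero_le_one) fun x hx => by
        linarith [heF u hu0 (fun t ht x hx => (huv t ht x hx).1) 0 h0T x hx,
          heF v hv0 (fun t ht x hx => (huv t ht x hx).2) 0 h0T x hx]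
    simpa using this
  have hdint : (∫ t in (0:ℝ)..T, ∫ x in (0:ℝ)..1, d (t, x)) = C * T -
      (∫ t in (0:ℝ)..T, ∫ x in (0:ℝ)..1,
        (u t x + v t x) ^ (2 * α) * ((u t x - v t x) / ε) ^ 2) / (24 * K ^ 2) := by
    obtain ⟨hIi, hIe⟩ := integral_integral_eq_setIntegral hT.le hIc
    obtain ⟨hCi, hCe⟩ := integral_integral_eq_setIntegral hT.le
      (continuousOn_const (c := C) (s := S))
    rw [(integral_integral_eq_setIntegral hT.le hdc).2, MeasureTheory.integral_sub hCi (hIi.div_const _),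
      MeasureTheory.integral_div, ← hIe, ← hCe]
    simp [mul_comm]
  rw [intervalIntegral.integral_neg] at hg0
  rw [hdint] at hbal
  have hfin : (∫ t in (0:ℝ)..T, ∫ x in (0:ℝ)..1,
      (u t x + v t x) ^ (2 * α) * ((u t x - v t x) / ε) ^ 2) / (24 * K ^ 2) ≤ C * T + 2 * F := by
    linarith
  rw [div_le_iff₀ (by positivity)] at hfin
  linarith

/-- Entropy production estimate for `α ∈ [-1,1]`: for admissible data there is a constant
`L`, independent of `ε`, such that `∫₀ᵀ∫₀¹ ρ_ε^{2α} j_ε² ≤ L` for every classical solution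
of the scaled generalized Carleman system, where `ρ_ε = u_ε + v_ε`, `j_ε = (u_ε - v_ε)/ε`. -/
theorem entropy_production_uniform_bound
    (α T : ℝ) (hα : α ∈ Set.Icc (-1:ℝ) 1) (hT : 0 < T)
    (φm φp uin vin : ℝ → ℝ) (hdata : AdmissibleData T φm φp uin vin) :
    ∃ L : ℝ, 0 < L ∧ ∀ ε : ℝ, 0 < ε → ∀ u v : ℝ → ℝ → ℝ,
      IsScaledCarlemanSol α T ε φm φp uin vin u v →
      (∫ t in (0:ℝ)..T, ∫ x in (0:ℝ)..1,
          (u t x + v t x) ^ (2 * α) * ((u t x - v t x) / ε) ^ 2) ≤ L := by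
  obtain ⟨hφm, hφp, hφ, huin, hvin, -⟩ := hdata
  obtain ⟨Km, hKm1, hKm, hKm'⟩ := exists_bound_log_add hT hφm fun t ht => (hφ t ht).1
  obtain ⟨Kp, hKp1, hKp, hKp'⟩ := exists_bound_log_add hT hφp fun t ht => (hφ t ht).2
  obtain ⟨Bu, hBu⟩ := isCompact_Icc.exists_bound_of_continuousOn huin
  obtain ⟨Bv, hBv⟩ := isCompact_Icc.exists_bound_of_continuousOn hvin
  have hK0 : 0 ≤ |Bu| + |Bv| := by positivity
  set K := Km + Kp + (|Bu| + |Bv|) with hK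
  have hK1 : 1 ≤ K := by linarith
  have hKmK : Km ≤ K := by linarith
  have hKpK : Kp ≤ K := by linarith
  refine ⟨24 * K ^ 2 * ((2 * K * Real.exp K + 2 * K ^ 2 + 2 * K + 24 * K ^ 4) * T
    + 2 * ((K + 1) ^ 2 + K * (K + 1) + Real.exp K)), by positivity, fun ε hε u v h => ?_⟩
  have hmax := h.le_of_data_le hε (M := K) (fun t ht => (hKm t ht).trans hKmK)
    (fun t ht => (hKp t ht).trans hKpK)
    (fun x hx => by
      linarith [(le_abs_self (uin x)).trans (hBu x hx), le_abs_self Bu, abs_nonneg Bv])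
    (fun x hx => by
      linarith [(le_abs_self (vin x)).trans (hBv x hx), le_abs_self Bv, abs_nonneg Bu])
  obtain ⟨z, hz, hzmin⟩ := (isCompact_Icc.prod isCompact_Icc).exists_isMinOn
    ((nonempty_Icc.mpr hT.le).prod (nonempty_Icc.mpr (zero_le_one (α := ℝ))))
    (h.1.continuousOn.add h.2.1.continuousOn)
  have hzpos := (h.2.2.1 z.1 hz.1 z.2 hz.2).2.2
  set κ := min 1 (u z.1 z.2 + v z.1 z.2) with hκdef
  have hκ : κ ∈ Ioc (0:ℝ) 1 := ⟨lt_min one_pos hzpos, min_le_left _ _⟩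
  have hlog : ∀ φ : ℝ → ℝ, ContDiffOn ℝ 1 φ (Icc 0 T) → (∀ t ∈ Icc 0 T, 0 < φ t) →
      ContDiffOn ℝ 1 (fun t => Real.log (φ t + κ)) (Icc 0 T) := fun φ hc hp =>
    (hc.add contDiffOn_const).log fun t ht => (add_pos (hp t ht) hκ.1).ne'
  exact h.integral_le_of_bounds hα hT hε hκ
    (fun t ht x hx => (min_le_right _ _).trans (isMinOn_iff.mp hzmin (t, x) ⟨ht, hx⟩)) hK1 hmax
    (hlog φm hφm fun t ht => (hφ t ht).1) (hlog φp hφp fun t ht => (hφ t ht).2)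
    (fun t _ => ⟨rfl, rfl⟩)
    (fun t ht => ((hKm' κ hκ).1 t ht).trans hKmK) (fun t ht => ((hKp' κ hκ).1 t ht).trans hKpK)
    (fun t ht => ((hKm' κ hκ).2 t ht).imp fun _ ha => ⟨ha.1, ha.2.trans hKmK⟩)
    (fun t ht => ((hKp' κ hκ).2 t ht).imp fun _ hb => ⟨hb.1, hb.2.trans hKpK⟩)
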